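/- There exists a computable sequence (sₙ) of rational numbers with ∑sᵢ < ∞ and sₙ → 0, but with no computable rate of convergence for sₙ → 0. -/

import Mathlib

open Filter Finset

theorem Primrec.nat_pow : Primrec₂ ((· ^ ·) : ℕ → ℕ → ℕ) :=
  Primrec₂.unpaired'.1 Nat.Primrec.pow

/-- The code of a pair consisting of an integer numerator and a natural denominator. -/
def ratCode (q : ℚ) : ℕ :=
  Nat.pair (Encodable.encode q.num) q.den

/-- A number codes a rational when the denominator it stores is positive and shares no divisor other
than one with the numerator it stores. -/
def IsRatCode (x : ℕ) : Prop :=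
  0 < x.unpair.2 ∧ ∀ d < x.unpair.2 + 1,
    ¬((x.unpair.1 + 1) / 2 % d = 0 ∧ x.unpair.2 % d = 0 ∧ d ≠ 1)

theorem natAbs_eq_encode_add_one_div_two (z : ℤ) : z.natAbs = (Encodable.encode z + 1) / 2 := by
  rcases z with n | n
  · change n = (2 * n + 1) / 2
    lia
  · change n + 1 = (2 * n + 1 + 1) / 2
    lia

theorem isRatCode_iff (x : ℕ) : IsRatCode x ↔ x ∈ Set.range ratCode := by
  constructor
  · rintro ⟨h0, h⟩
    have hz := natAbs_eq_encode_add_one_div_two (Denumerable.ofNat ℤ x.unpair.1)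
    rw [Denumerable.encode_ofNat] at hz
    refine ⟨⟨Denumerable.ofNat ℤ x.unpair.1, x.unpair.2, h0.ne', ?_⟩, ?_⟩
    · rw [hz]
      by_contra hne
      refine h _ (Nat.lt_succ_of_le (Nat.gcd_le_right _ h0)) ⟨?_, ?_, hne⟩
      · exact Nat.mod_eq_zero_of_dvd (Nat.gcd_dvd_left _ _)
      · exact Nat.mod_eq_zero_of_dvd (Nat.gcd_dvd_right _ _)
    · change Nat.pair (Encodable.encode (Denumerable.ofNat ℤ x.unpair.1)) x.unpair.2 = x
      rw [Denumerable.encode_ofNat, Nat.pair_unpair]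
  · rintro ⟨q, rfl⟩
    simp only [IsRatCode, ratCode, Nat.unpair_pair]
    refine ⟨q.den_pos, fun d _ ⟨h1, h2, h3⟩ => h3 ?_⟩
    rw [← natAbs_eq_encode_add_one_div_two] at h1
    exact Nat.eq_one_of_dvd_coprimes q.reduced (Nat.dvd_of_mod_eq_zero h1)
      (Nat.dvd_of_mod_eq_zero h2)

theorem primrecPred_isRatCode : PrimrecPred IsRatCode := by
  have hl : Primrec fun x : ℕ => x.unpair.1 := Primrec.fst.comp Primrec.unpair
  have hr : Primrec fun x : ℕ => x.unpair.2 := Primrec.snd.comp Primrec.unpair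
  have hR : PrimrecRel fun d x : ℕ =>
      ¬((x.unpair.1 + 1) / 2 % d = 0 ∧ x.unpair.2 % d = 0 ∧ d ≠ 1) := by
    refine PrimrecPred.not (.and ?_ (.and ?_ (.not ?_)))
    · exact Primrec.eq.comp (Primrec.nat_mod.comp (Primrec.nat_div.comp
        (Primrec.succ.comp (hl.comp .snd)) (.const 2)) .fst) (.const 0)
    · exact Primrec.eq.comp (Primrec.nat_mod.comp (hr.comp .snd) .fst) (.const 0)
    · exact Primrec.eq.comp .fst (.const 1)
  exact (Primrec.nat_lt.comp (.const 0) hr).and (hR.forall_lt.comp (Primrec.succ.comp hr) .id)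

open Classical in
theorem encode_rat_eq_countP (q : ℚ) :
    @Encodable.encode ℚ Primcodable.toEncodable q =
      ((List.range (ratCode q)).filter (IsRatCode ·)).length := by
  rw [← List.countP_eq_length_filter]
  have h : @Encodable.encode ℚ Primcodable.toEncodable q = (List.range (ratCode q)).countP
      (fun x => @decide (x ∈ Set.range (@Encodable.encode ℚ Rat.instEncodable))
        (@Encodable.decidableRangeEncode ℚ Rat.instEncodable x)) := rfl
  have hrange : Set.range (@Encodable.encode ℚ Rat.instEncodable) = Set.range ratCode := rfl
  rw [h]
  congr 1
  funext x
  simp only [isRatCode_iff, hrange]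

/-- A sequence of rationals is primitive recursive as soon as its numerators (up to coding) and
denominators are. -/
theorem primrec_of_ratCode {f : ℕ → ℚ} (hf : Primrec fun n => ratCode (f n)) : Primrec f := by
  classical
  rw [← Primrec.encode_iff]
  simp only [encode_rat_eq_countP]
  exact Primrec.list_length.comp
    ((Primrec.listFilter primrecPred_isRatCode).comp (Primrec.list_range.comp hf))

theorem primrec_half_pow : Primrec fun m : ℕ => (1 / 2 : ℚ) ^ m := by
  refine primrec_of_ratCode ?_
  have h (m : ℕ) : Nat.pair (Encodable.encode (1 : ℤ)) (2 ^ m) = ratCode ((1 / 2 : ℚ) ^ m) := by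
    rw [ratCode, Rat.num_pow, Rat.den_pow]
    norm_num
  exact (Primrec₂.natPair.comp (.const _) (Primrec.nat_pow.comp (.const 2) .id)).of_eq h

open Nat.Partrec (Code)

/-- The code with number `m` halts on input zero within `k` steps. -/
def HaltsWithin (m k : ℕ) : Prop :=
  (Code.evaln k (Denumerable.ofNat Code m) 0).isSome

/-- The code with number `n.unpair.1` halts on input zero in exactly `n.unpair.2` steps. -/
def HaltsAt (n : ℕ) : Prop :=
  HaltsWithin n.unpair.1 n.unpair.2 ∧ ¬HaltsWithin n.unpair.1 (n.unpair.2 - 1)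

theorem HaltsWithin.mono {m k l : ℕ} (hkl : k ≤ l) (h : HaltsWithin m k) : HaltsWithin m l := by
  obtain ⟨x, hx⟩ := Option.isSome_iff_exists.1 h
  exact Option.isSome_iff_exists.2 ⟨x, Code.evaln_mono hkl hx⟩

theorem not_haltsWithin_zero (m : ℕ) : ¬HaltsWithin m 0 := by
  intro h
  obtain ⟨x, hx⟩ := Option.isSome_iff_exists.1 h
  exact absurd (Code.evaln_bound hx) (lt_irrefl 0)

theorem exists_haltsWithin_iff (c : Code) :
    (∃ k, HaltsWithin (Encodable.encode c) k) ↔ (c.eval 0).Dom := by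
  simp only [HaltsWithin, Denumerable.ofNat_encode, Option.isSome_iff_exists, Part.dom_iff_mem,
    Code.evaln_complete]
  exact exists_comm

theorem primrecRel_haltsWithin : PrimrecRel HaltsWithin := by
  have h : Primrec fun p : ℕ × ℕ => (Code.evaln p.2 (Denumerable.ofNat Code p.1) 0).isSome :=
    Primrec.option_isSome.comp (Code.primrec_evaln.comp
      ((Primrec.snd.pair ((Primrec.ofNat Code).comp Primrec.fst)).pair (Primrec.const 0)))
  exact Primrec.eq.comp h (.const true)

theorem primrecPred_haltsAt : PrimrecPred HaltsAt := by
  have hl : Primrec fun x : ℕ => x.unpair.1 := Primrec.fst.comp Primrec.unpair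
  have hr : Primrec fun x : ℕ => x.unpair.2 := Primrec.snd.comp Primrec.unpair
  exact (primrecRel_haltsWithin.comp hl hr).and
    (primrecRel_haltsWithin.comp hl (Primrec.pred.comp hr)).not

theorem HaltsAt.le {n k : ℕ} (h : HaltsAt n) (hk : HaltsWithin n.unpair.1 k) :
    n.unpair.2 ≤ k := by
  by_contra hlt
  exact h.2 (hk.mono (by lia))

theorem injOn_unpair_fst_haltsAt : Set.InjOn (fun n : ℕ => n.unpair.1) {n | HaltsAt n} := by
  intro a ha b hb hab
  have hab : a.unpair.1 = b.unpair.1 := hab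
  have h2 : a.unpair.2 = b.unpair.2 :=
    le_antisymm (HaltsAt.le ha (hab ▸ hb.1)) (HaltsAt.le hb (hab ▸ ha.1))
  rw [← Nat.pair_unpair a, ← Nat.pair_unpair b, hab, h2]

theorem HaltsWithin.exists_haltsAt {m k : ℕ} (h : HaltsWithin m k) :
    ∃ l, HaltsAt (Nat.pair m l) := by
  classical
  have hex : ∃ k, HaltsWithin m k := ⟨k, h⟩
  refine ⟨Nat.find hex, ?_⟩
  simp only [HaltsAt, Nat.unpair_pair]
  refine ⟨Nat.find_spec hex, Nat.find_min hex (Nat.sub_lt ?_ one_pos)⟩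
  exact (Nat.find_pos hex).2 (not_haltsWithin_zero m)

open Classical in
/-- The sequence taking the value `2⁻ᵐ` at the time when the code with number `m` halts. -/
noncomputable def haltingSeq (n : ℕ) : ℚ :=
  if HaltsAt n then (1 / 2) ^ n.unpair.1 else 0

theorem computable_haltingSeq : Computable haltingSeq := by
  classical
  exact (Primrec.ite primrecPred_haltsAt
    (primrec_half_pow.comp (Primrec.fst.comp Primrec.unpair)) (.const 0)).to_comp

theorem summable_haltingSeq : Summable fun n => (haltingSeq n : ℝ) := by
  have h : Summable ((fun n : ℕ => (1 / 2 : ℝ) ^ n.unpair.1) ∘ ((↑) : {n | HaltsAt n} → ℕ)) :=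
    summable_geometric_two.comp_injective injOn_unpair_fst_haltsAt.injective
  refine (summable_subtype_iff_indicator.1 h).congr fun n => ?_
  by_cases hn : HaltsAt n <;> simp [haltingSeq, Set.indicator, hn]

theorem not_computable_rate_haltingSeq {φ : ℚ → ℕ} (hφ : Computable φ)
    (h : ∀ ε : ℚ, 0 < ε → ∀ n, φ ε ≤ n → |haltingSeq n| ≤ ε) : False := by
  have hbound (m : ℕ) : (∃ k, HaltsWithin m k) ↔ HaltsWithin m (φ ((1 / 2) ^ (m + 1))) := by
    refine ⟨fun ⟨k, hk⟩ => ?_, fun hk => ⟨_, hk⟩⟩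
    obtain ⟨l, hl⟩ := hk.exists_haltsAt
    have hlt : Nat.pair m l < φ ((1 / 2) ^ (m + 1)) := by
      by_contra! hle
      have hs := h _ (by positivity) _ hle
      rw [haltingSeq, if_pos hl, Nat.unpair_pair, abs_of_pos (by positivity), pow_succ] at hs
      have hpos : (0 : ℚ) < (1 / 2) ^ m := by positivity
      dsimp only at hs
      linarith
    have hw := hl.1
    rw [Nat.unpair_pair] at hw
    exact hw.mono ((Nat.right_le_pair m l).trans hlt.le)
  refine ComputablePred.halting_problem 0 ?_
  simp only [← exists_haltsWithin_iff, hbound]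
  obtain ⟨_, hdec⟩ := primrecRel_haltsWithin.computablePred
  refine ⟨fun c => inferInstanceAs (Decidable ((fun p : ℕ × ℕ => HaltsWithin p.1 p.2) (_, _))), ?_⟩
  exact hdec.comp (Computable.encode.pair
    (hφ.comp (primrec_half_pow.to_comp.comp (Computable.succ.comp Computable.encode))))

/-- There exists a computable sequence (sₙ) of rationals with ∑sᵢ < ∞ and
sₙ → 0, but with no computable rate of convergence for sₙ → 0. -/
theorem stmt9 :
    ∃ s : ℕ → ℚ, Computable s ∧
      Summable (fun n => (s n : ℝ)) ∧
      Tendsto (fun n => (s n : ℝ)) atTop (nhds 0) ∧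
      ¬∃ φ : ℚ → ℕ, Computable φ ∧
        ∀ ε : ℚ, 0 < ε → ∀ n, φ ε ≤ n → |s n| ≤ ε :=
  ⟨haltingSeq, computable_haltingSeq, summable_haltingSeq,
    summable_haltingSeq.tendsto_atTop_zero,
    fun ⟨_, hφ, h⟩ => not_computable_rate_haltingSeq hφ h⟩
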